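/- Let X be a finite-dimensional real normed vector space, A ⊂ X be a closed set, and let f and φ be lower semicontinuous on A. Then the penalty function F_λ is (globally) exact if and only if the following two conditions hold: (1) F_λ is non-degenerate; (2) F_λ is exact at every globally optimal solution of the problem (P). -/

import Mathlib

open Filter Topology Set

/-- The linear penalty function `F_λ = f + λ φ`. -/
noncomputable def penaltyFun {X : Type*} (f : X → EReal) (φ : X → ℝ) (lam : ℝ) : X → EReal :=
  fun x => f x + ((lam * φ x : ℝ) : EReal)

/-- The penalty function `F_λ` is (locally) exact at `x`. -/
def ExactPenaltyAt {X : Type*} [TopologicalSpace X] (f : X → EReal) (φ : X → ℝ)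
    (A : Set X) (x : X) : Prop :=
  ∃ lam : ℝ, 0 ≤ lam ∧ IsLocalMinOn (penaltyFun f φ lam) A x

/-- The penalty function `F_λ` is globally exact. -/
def GloballyExact {X : Type*} (f : X → EReal) (φ : X → ℝ) (A M : Set X) : Prop :=
  ∃ lam0 : ℝ, 0 ≤ lam0 ∧ ∀ lam : ℝ, lam0 < lam →
    {x | x ∈ A ∧ ∀ y ∈ A, penaltyFun f φ lam x ≤ penaltyFun f φ lam y} =
      {x | x ∈ M ∩ A ∧ ∀ y ∈ M ∩ A, f x ≤ f y}

/-- The penalty function `F_λ` is non-degenerate: for some `λ₀ ≥ 0`, `F_λ` attains a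
global minimum on `A` for every `λ ≥ λ₀`, and there is a bounded selection of global
minimizers. -/
def NonDegenerate {X : Type*} [NormedAddCommGroup X] (f : X → EReal) (φ : X → ℝ)
    (A : Set X) : Prop :=
  ∃ lam0 : ℝ, 0 ≤ lam0 ∧
    (∀ lam : ℝ, lam0 ≤ lam →
      ∃ z ∈ A, ∀ y ∈ A, penaltyFun f φ lam z ≤ penaltyFun f φ lam y) ∧
    ∃ x : ℝ → X,
      (∀ lam : ℝ, lam0 ≤ lam →
        x lam ∈ A ∧ ∀ y ∈ A, penaltyFun f φ lam (x lam) ≤ penaltyFun f φ lam y) ∧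
      Bornology.IsBounded (x '' Set.Ici lam0)

section PenaltyFun

variable {X : Type*} {f : X → EReal} {φ : X → ℝ}

theorem penaltyFun_of_eq_zero {x : X} (hx : φ x = 0) (lam : ℝ) :
    penaltyFun f φ lam x = f x := by
  simp [penaltyFun, hx]

theorem penaltyFun_of_eq_coe {x : X} {r : ℝ} (hr : f x = r) (lam : ℝ) :
    penaltyFun f φ lam x = ((r + lam * φ x : ℝ) : EReal) := by
  simp only [penaltyFun, hr, EReal.coe_add]

theorem penaltyFun_mono {x : X} (hx : 0 ≤ φ x) : Monotone fun lam => penaltyFun f φ lam x :=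
  fun _ _ h => add_le_add le_rfl (EReal.coe_le_coe_iff.2 (mul_le_mul_of_nonneg_right h hx))

theorem le_penaltyFun {x : X} (hx : 0 ≤ φ x) {lam : ℝ} (hlam : 0 ≤ lam) :
    f x ≤ penaltyFun f φ lam x := by
  simpa [penaltyFun] using penaltyFun_mono (f := f) hx hlam

/-- If the penalty function is bounded below on `A` by the optimal value for some parameter,
then it is globally exact. -/
theorem globallyExact_of_forall_le {A : Set X} (hfbot : ∀ x, f x ≠ ⊥) (hφnn : ∀ x, 0 ≤ φ x)
    {z : X} (hzA : z ∈ A) (hzM : φ z = 0) (hz : f z ≠ ⊤) {lam₁ : ℝ} (hlam₁ : 0 ≤ lam₁)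
    (h : ∀ y ∈ A, f z ≤ penaltyFun f φ lam₁ y) :
    GloballyExact f φ A {x | φ x = 0} := by
  refine ⟨lam₁, hlam₁, fun lam hlam => Set.ext fun x => ⟨?_, ?_⟩⟩
  · rintro ⟨hxA, hx⟩
    have hxz : penaltyFun f φ lam x ≤ f z := by
      simpa only [penaltyFun_of_eq_zero hzM] using hx z hzA
    have hfx : f x ≤ f z := (le_penaltyFun (hφnn x) (hlam₁.trans hlam.le)).trans hxz
    obtain ⟨r, hr⟩ : ∃ r : ℝ, f x = r :=
      ⟨_, (EReal.coe_toReal (ne_top_of_le_ne_top hz hfx) (hfbot x)).symm⟩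
    have hle := hxz.trans (h x hxA)
    rw [penaltyFun_of_eq_coe hr, penaltyFun_of_eq_coe hr, EReal.coe_le_coe_iff] at hle
    have hφx : φ x = 0 := by nlinarith [hφnn x]
    refine ⟨⟨hφx, hxA⟩, fun y hy => hfx.trans ?_⟩
    simpa only [penaltyFun_of_eq_zero hy.1] using h y hy.2
  · rintro ⟨⟨hxM, hxA⟩, hx⟩
    refine ⟨hxA, fun y hy => ?_⟩
    rw [penaltyFun_of_eq_zero hxM]
    exact (hx z ⟨hzM, hzA⟩).trans ((h y hy).trans (penaltyFun_mono (hφnn y) hlam.le))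

/-- A limit of points at which the penalty functions, with parameters tending to infinity, stay
below a finite value `v` is feasible and has objective value at most `v`. -/
theorem eq_zero_and_le_of_tendsto [TopologicalSpace X] {A : Set X} (hfbot : ∀ x, f x ≠ ⊥)
    (hφnn : ∀ x, 0 ≤ φ x) (hflsc : LowerSemicontinuousOn f A)
    (hφlsc : LowerSemicontinuousOn φ A) {v : EReal} (hv : v ≠ ⊤) {a : X} (ha : a ∈ A)
    {u : ℕ → X} {lam : ℕ → ℝ} (hlam : Tendsto lam atTop atTop)
    (hu : Tendsto u atTop (𝓝[A] a)) (hle : ∀ n, penaltyFun f φ (lam n) (u n) ≤ v) :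
    φ a = 0 ∧ f a ≤ v := by
  have hfu : ∀ᶠ n in atTop, f (u n) ≤ v := by
    filter_upwards [hlam.eventually_ge_atTop 0] with n hn
    exact (le_penaltyFun (hφnn _) hn).trans (hle n)
  refine ⟨?_, ?_⟩
  · by_contra hne
    have hpos : 0 < φ a := lt_of_le_of_ne (hφnn a) (Ne.symm hne)
    obtain ⟨c, -, hc⟩ := EReal.lt_iff_exists_real_btwn.1 (bot_lt_iff_ne_bot.2 (hfbot a))
    obtain ⟨w, hw, -⟩ := EReal.lt_iff_exists_real_btwn.1 (lt_top_iff_ne_top.2 hv)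
    obtain ⟨n, hcn, hφn, hn, hn0⟩ := ((hu.eventually (hflsc a ha c hc)).and
      ((hu.eventually (hφlsc a ha _ (half_lt_self hpos))).and
        ((hlam.eventually_ge_atTop ((w - c) / (φ a / 2))).and
          (hlam.eventually_ge_atTop 0)))).exists
    have hsum : ((c + lam n * φ (u n) : ℝ) : EReal) < w := by
      rw [EReal.coe_add]
      exact (add_le_add hcn.le le_rfl).trans_lt ((hle n).trans_lt hw)
    rw [EReal.coe_lt_coe_iff] at hsum
    rw [div_le_iff₀ (half_pos hpos)] at hn
    nlinarith [mul_le_mul_of_nonneg_left hφn.le hn0]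
  · by_contra! hlt
    obtain ⟨n, hn, hn'⟩ := ((hu.eventually (hflsc a ha v hlt)).and hfu).exists
    exact hn.not_ge hn'

end PenaltyFun

/-- Theorem: in a finite-dimensional normed space, with `A` closed and `f`, `φ` lower
semicontinuous on `A`, the penalty function `F_λ` is globally exact iff it is
non-degenerate and exact at every globally optimal solution of the problem `(𝒫)`. -/
theorem globallyExact_iff_nonDegenerate_and_exact_at_solutions {X : Type*}
    [NormedAddCommGroup X] [NormedSpace ℝ X] [FiniteDimensional ℝ X]
    (f : X → EReal) (φ : X → ℝ) (A M : Set X)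
    (hAne : A.Nonempty) (hMne : M.Nonempty)
    (hfbot : ∀ x, f x ≠ ⊥) (hφnn : ∀ x, 0 ≤ φ x) (hMdef : M = {x | φ x = 0})
    (hattain : ∃ z ∈ M ∩ A, (∀ y ∈ M ∩ A, f z ≤ f y) ∧ f z ≠ ⊤)
    (hAclosed : IsClosed A)
    (hflsc : LowerSemicontinuousOn f A) (hφlsc : LowerSemicontinuousOn (fun x => (φ x : ℝ)) A) :
    GloballyExact f φ A M ↔
      (NonDegenerate f φ A ∧
        ∀ xs : X, xs ∈ M ∩ A → (∀ y ∈ M ∩ A, f xs ≤ f y) → f xs ≠ ⊤ →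
          ExactPenaltyAt f φ A xs) := by
  subst hMdef
  obtain ⟨z, hz, hzmin, hztop⟩ := hattain
  constructor
  · rintro ⟨lam0, hlam0, h⟩
    have hmin : ∀ lam, lam0 + 1 ≤ lam → ∀ x ∈ {x | φ x = 0} ∩ A,
        (∀ y ∈ {x | φ x = 0} ∩ A, f x ≤ f y) →
          x ∈ A ∧ ∀ y ∈ A, penaltyFun f φ lam x ≤ penaltyFun f φ lam y :=
      fun lam hlam x hx hxmin => (h lam (by linarith)).ge ⟨hx, hxmin⟩
    refine ⟨⟨lam0 + 1, by linarith, fun lam hlam => ⟨z, hmin lam hlam z hz hzmin⟩,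
      fun _ => z, fun lam hlam => hmin lam hlam z hz hzmin, ?_⟩, ?_⟩
    · exact Bornology.isBounded_singleton.subset (by rintro _ ⟨_, _, rfl⟩; rfl)
    · exact fun xs hxs hxsmin _ => ⟨lam0 + 1, by linarith,
        eventually_nhdsWithin_of_forall (hmin _ le_rfl xs hxs hxsmin).2⟩
  · rintro ⟨⟨lam0, hlam0, -, x, hx, hbdd⟩, hexact⟩
    have hge (n : ℕ) : lam0 ≤ lam0 + n := le_add_of_nonneg_right n.cast_nonneg
    obtain ⟨a, -, ψ, hψ, hlim⟩ := tendsto_subseq_of_bounded hbdd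
      (x := fun n : ℕ => x (lam0 + n)) fun n => mem_image_of_mem x (hge n)
    have hA (n : ℕ) : x (lam0 + ψ n) ∈ A := (hx _ (hge _)).1
    have ha : a ∈ A := hAclosed.mem_of_tendsto hlim (Eventually.of_forall hA)
    have hu : Tendsto (fun n => x (lam0 + ψ n)) atTop (𝓝[A] a) :=
      tendsto_nhdsWithin_iff.2 ⟨hlim, Eventually.of_forall hA⟩
    have hlam : Tendsto (fun n => lam0 + (ψ n : ℝ)) atTop atTop :=
      tendsto_atTop_add_const_left _ _ (tendsto_natCast_atTop_atTop.comp hψ.tendsto_atTop)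
    obtain ⟨haM, haz⟩ := eq_zero_and_le_of_tendsto hfbot hφnn hflsc hφlsc hztop ha hlam hu
      fun n => by simpa only [penaltyFun_of_eq_zero hz.1] using (hx _ (hge (ψ n))).2 z hz.2
    have hatop : f a ≠ ⊤ := ne_top_of_le_ne_top hztop haz
    obtain ⟨lam, -, hloc⟩ := hexact a ⟨haM, ha⟩ (fun y hy => haz.trans (hzmin y hy)) hatop
    obtain ⟨n, hn, hn'⟩ := ((hu.eventually hloc).and (hlam.eventually_ge_atTop lam)).exists
    rw [penaltyFun_of_eq_zero haM] at hn
    exact globallyExact_of_forall_le hfbot hφnn ha haM hatop (hlam0.trans (hge (ψ n)))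
      fun y hy => (hn.trans (penaltyFun_mono (hφnn _) hn')).trans ((hx _ (hge _)).2 y hy)
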